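/- arXiv:2305.02472 — 9 statements merged into one kernel-verified Lean document; each statement's English description precedes it below -/
import Mathlib

section
/- Let r, m, p be positive natural numbers, let A be an r×r real matrix, B an r×m real matrix, C a p×r real matrix, and let λ_1, …, λ_p be real numbers with 0 ≤ λ_i < 1 for each i. Then the following are equivalent: (i) there exist a matrix K ∈ ℝ^{m×r} and a symmetric positive definite matrix P ∈ ℝ^{r×r} such that (A+BK) P (A+BK)ᵀ − P is negative definite and, for every i ∈ {1,…,p}, C_i (A+BK) = λ_i C_i, where C_i denotes the i-th row of C; (ii) there exist a symmetric positive definite matrix M ∈ ℝ^{r×r} and a matrix N ∈ ℝ^{m×r} such that the 2r×2r block matrix [[M, AM+BN],[(AM+BN)ᵀ, M]] is positive definite and, for every i ∈ {1,…,p}, C_i (AM+BN) = λ_i C_i M. Moreover, if (ii) holds with M and N, then K = N M^{-1} together with P = M satisfies (i). -/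
open Matrix

/-- **Schur complement criterion**: a block matrix with positive definite lower right block is
positive definite iff the Schur complement of that block is. -/
theorem posDef_fromBlocks_iff_schur {m n : Type*} [Fintype m] [Fintype n] [DecidableEq m]
    [DecidableEq n] (P : Matrix m m ℝ) (X : Matrix m n ℝ) {M : Matrix n n ℝ} (hM : M.PosDef) :
    (fromBlocks P X Xᵀ M).PosDef ↔ (P - X * M⁻¹ * Xᵀ).PosDef := by
  let _ : Invertible M := hM.isUnit.invertible
  have hpsd := PosDef.fromBlocks₂₂ P X hM
  have hunit := isUnit_fromBlocks_iff_of_invertible₂₂ (A := P) (B := X) (C := Xᵀ) (D := M)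
  rw [conjTranspose_eq_transpose_of_trivial] at hpsd
  rw [invOf_eq_nonsing_inv] at hunit
  constructor
  · intro h
    exact (hpsd.1 h.posSemidef).posDef_iff_isUnit.2 (hunit.1 h.isUnit)
  · intro h
    exact (hpsd.2 h.posSemidef).posDef_iff_isUnit.2 (hunit.2 h.isUnit)

/-- The Stein inequality `F M Fᵀ - M < 0` as a linear matrix inequality in `M` and `F M`. -/
theorem posDef_fromBlocks_mul_iff_stein {n : Type*} [Fintype n] [DecidableEq n]
    (F : Matrix n n ℝ) {M : Matrix n n ℝ} (hM : M.PosDef) :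
    (fromBlocks M (F * M) (F * M)ᵀ M).PosDef ↔ (-(F * M * Fᵀ - M)).PosDef := by
  have hMT : Mᵀ = M := by simpa using hM.isHermitian.eq
  have hdet : IsUnit M.det := (isUnit_iff_isUnit_det M).1 hM.isUnit
  rw [posDef_fromBlocks_iff_schur M (F * M) hM, mul_nonsing_inv_cancel_right _ _ hdet,
    transpose_mul, hMT, ← Matrix.mul_assoc, neg_sub]

/-- Model-based monotonic tracking: equivalence between the Lyapunov/left-eigenvector
conditions on a feedback gain `K` and the LMI conditions in `M`, `N`; moreover
`K = N M⁻¹`, `P = M` realizes the first set of conditions from the second. -/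
theorem stmt_0 (r m p : ℕ) (hr : 0 < r) (hm : 0 < m) (hp : 0 < p)
    (A : Matrix (Fin r) (Fin r) ℝ) (B : Matrix (Fin r) (Fin m) ℝ)
    (C : Matrix (Fin p) (Fin r) ℝ) (lam : Fin p → ℝ)
    (hlam : ∀ i, 0 ≤ lam i ∧ lam i < 1) :
    ((∃ (K : Matrix (Fin m) (Fin r) ℝ) (P : Matrix (Fin r) (Fin r) ℝ),
        P.PosDef ∧ (-((A + B * K) * P * (A + B * K)ᵀ - P)).PosDef ∧
        ∀ i j, (C * (A + B * K)) i j = lam i * C i j) ↔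
      (∃ (M : Matrix (Fin r) (Fin r) ℝ) (N : Matrix (Fin m) (Fin r) ℝ),
        M.PosDef ∧ (fromBlocks M (A * M + B * N) (A * M + B * N)ᵀ M).PosDef ∧
        ∀ i j, (C * (A * M + B * N)) i j = lam i * (C * M) i j)) ∧
    (∀ (M : Matrix (Fin r) (Fin r) ℝ) (N : Matrix (Fin m) (Fin r) ℝ),
      M.PosDef → (fromBlocks M (A * M + B * N) (A * M + B * N)ᵀ M).PosDef →
      (∀ i j, (C * (A * M + B * N)) i j = lam i * (C * M) i j) →
      M.PosDef ∧
      (-((A + B * (N * M⁻¹)) * M * (A + B * (N * M⁻¹))ᵀ - M)).PosDef ∧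
      ∀ i j, (C * (A + B * (N * M⁻¹))) i j = lam i * C i j) := by
  have key : ∀ (M : Matrix (Fin r) (Fin r) ℝ) (N : Matrix (Fin m) (Fin r) ℝ),
      M.PosDef → (fromBlocks M (A * M + B * N) (A * M + B * N)ᵀ M).PosDef →
      (∀ i j, (C * (A * M + B * N)) i j = lam i * (C * M) i j) →
      M.PosDef ∧
      (-((A + B * (N * M⁻¹)) * M * (A + B * (N * M⁻¹))ᵀ - M)).PosDef ∧
      ∀ i j, (C * (A + B * (N * M⁻¹))) i j = lam i * C i j := by
    intro M N hM hblock hC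
    have hdet : IsUnit M.det := (isUnit_iff_isUnit_det M).1 hM.isUnit
    have hF : (A + B * (N * M⁻¹)) * M = A * M + B * N := by
      rw [Matrix.add_mul, Matrix.mul_assoc B, nonsing_inv_mul_cancel_right _ _ hdet]
    rw [← hF] at hblock hC
    refine ⟨hM, (posDef_fromBlocks_mul_iff_stein _ hM).1 hblock, fun i j => ?_⟩
    have hCM : C * (A + B * (N * M⁻¹)) * M = diagonal lam * C * M := by
      ext i j
      rw [Matrix.mul_assoc, Matrix.mul_assoc, diagonal_mul]
      exact hC i j
    have hCF := congrArg (· * M⁻¹) hCM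
    simp only [mul_nonsing_inv_cancel_right _ _ hdet] at hCF
    rw [hCF, diagonal_mul]
  refine ⟨⟨?_, fun ⟨M, N, hM, hblock, hC⟩ => ⟨N * M⁻¹, M, key M N hM hblock hC⟩⟩, key⟩
  rintro ⟨K, P, hP, hstein, hC⟩
  have hF : A * P + B * (K * P) = (A + B * K) * P := by
    rw [Matrix.add_mul, Matrix.mul_assoc]
  have hCF : C * (A + B * K) = diagonal lam * C := by
    ext i j
    rw [diagonal_mul]
    exact hC i j
  refine ⟨P, K * P, hP, ?_, fun i j => ?_⟩
  · rw [hF]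
    exact (posDef_fromBlocks_mul_iff_stein _ hP).2 hstein
  · rw [hF, ← Matrix.mul_assoc, hCF, Matrix.mul_assoc, diagonal_mul]
end

section
/- Let r and ℓ be positive natural numbers, let A ∈ ℝ^{r×r}, B ∈ ℝ^{r×1}, C ∈ ℝ^{1×r}, and let λ be a real number with 0 ≤ λ < 1. Let U0 ∈ ℝ^{1×ℓ} and Z0, Z1 ∈ ℝ^{r×ℓ} be matrices satisfying the data-consistency relation Z1 = A Z0 + B U0, and assume the (r+1)×ℓ stacked matrix [U0; Z0] has rank r+1 (full row rank). Then the following are equivalent: (i) there exist K ∈ ℝ^{1×r} and a symmetric positive definite P ∈ ℝ^{r×r} such that (A+BK) P (A+BK)ᵀ − P is negative definite and C(A+BK) = λ C; (ii) there exist a symmetric positive definite P ∈ ℝ^{r×r} and Q ∈ ℝ^{ℓ×r} such that the 2r×2r block matrix [[P, Z1 Q],[(Z1 Q)ᵀ, P]] is positive definite, Z0 Q = P, and C Z1 Q = λ C P. Moreover, if (ii) holds with P and Q, then K = U0 Q P^{-1} satisfies (i) with the same P. -/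
open Matrix

/-- Strict Schur complement criterion for a positive definite lower right block. -/
theorem Matrix.PosDef.fromBlocks₂₂_iff {m n : Type*} [Fintype m] [Fintype n]
    [DecidableEq m] [DecidableEq n] (A : Matrix m m ℝ) (B : Matrix m n ℝ)
    {D : Matrix n n ℝ} (hD : D.PosDef) :
    (fromBlocks A B Bᵀ D).PosDef ↔ (A - B * D⁻¹ * Bᵀ).PosDef := by
  have : Invertible D := hD.isUnit.invertible
  have hsemi := PosDef.fromBlocks₂₂ A B hD
  rw [conjTranspose_eq_transpose_of_trivial] at hsemi
  have hunit := isUnit_fromBlocks_iff_of_invertible₂₂ (A := A) (B := B) (C := Bᵀ) (D := D)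
  rw [invOf_eq_nonsing_inv] at hunit
  constructor
  · intro h
    exact (hsemi.1 h.posSemidef).posDef_iff_isUnit.2 (hunit.1 h.isUnit)
  · intro h
    exact (hsemi.2 h.posSemidef).posDef_iff_isUnit.2 (hunit.2 h.isUnit)

/-- The block inequality is the discrete Lyapunov inequality for `F`. -/
theorem posDef_fromBlocks_iff_lyapunov {n : Type*} [Fintype n] [DecidableEq n]
    (F : Matrix n n ℝ) {P : Matrix n n ℝ} (hP : P.PosDef) :
    (fromBlocks P (F * P) (F * P)ᵀ P).PosDef ↔ (-(F * P * Fᵀ - P)).PosDef := by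
  have hdet : IsUnit P.det := (isUnit_iff_isUnit_det P).1 hP.isUnit
  have hsymm : Pᵀ = P := by
    simpa [conjTranspose_eq_transpose_of_trivial] using hP.isHermitian.eq
  rw [Matrix.PosDef.fromBlocks₂₂_iff P (F * P) hP, mul_nonsing_inv_cancel_right _ _ hdet,
    transpose_mul, hsymm, ← Matrix.mul_assoc, neg_sub]

/-- A matrix of full row rank has a right inverse. -/
theorem exists_mul_eq_one_of_rank_eq_card {m n : Type*} [Fintype m] [Fintype n]
    [DecidableEq m] (M : Matrix m n ℝ) (h : M.rank = Fintype.card m) :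
    ∃ N : Matrix n m ℝ, M * N = 1 := by
  rw [← mulVec_surjective_iff_exists_right_inverse]
  have htop : LinearMap.range M.mulVecLin = ⊤ :=
    Submodule.eq_top_of_finrank_eq (by simpa [Matrix.rank] using h)
  exact LinearMap.range_eq_top.1 htop

/-- Data-based monotonic tracking for SISO systems: equivalence between the
model-based Lyapunov/left-eigenvector conditions and the data-dependent LMI
conditions; moreover `K = U0 Q P⁻¹` realizes the first conditions with the same `P`. -/
theorem stmt_1 (r ℓ : ℕ) (hr : 0 < r) (hℓ : 0 < ℓ)
    (A : Matrix (Fin r) (Fin r) ℝ) (B : Matrix (Fin r) (Fin 1) ℝ)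
    (C : Matrix (Fin 1) (Fin r) ℝ) (lam : ℝ) (hlam : 0 ≤ lam ∧ lam < 1)
    (U0 : Matrix (Fin 1) (Fin ℓ) ℝ) (Z0 Z1 : Matrix (Fin r) (Fin ℓ) ℝ)
    (hdata : Z1 = A * Z0 + B * U0)
    (hrank : (fromRows U0 Z0).rank = r + 1) :
    ((∃ (K : Matrix (Fin 1) (Fin r) ℝ) (P : Matrix (Fin r) (Fin r) ℝ),
        P.PosDef ∧ (-((A + B * K) * P * (A + B * K)ᵀ - P)).PosDef ∧
        C * (A + B * K) = lam • C) ↔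
      (∃ (P : Matrix (Fin r) (Fin r) ℝ) (Q : Matrix (Fin ℓ) (Fin r) ℝ),
        P.PosDef ∧ (fromBlocks P (Z1 * Q) (Z1 * Q)ᵀ P).PosDef ∧
        Z0 * Q = P ∧ C * Z1 * Q = lam • (C * P))) ∧
    (∀ (P : Matrix (Fin r) (Fin r) ℝ) (Q : Matrix (Fin ℓ) (Fin r) ℝ),
      P.PosDef → (fromBlocks P (Z1 * Q) (Z1 * Q)ᵀ P).PosDef →
      Z0 * Q = P → C * Z1 * Q = lam • (C * P) →
      (-((A + B * (U0 * Q * P⁻¹)) * P * (A + B * (U0 * Q * P⁻¹))ᵀ - P)).PosDef ∧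
      C * (A + B * (U0 * Q * P⁻¹)) = lam • C) := by
  have hclosed : ∀ (P : Matrix (Fin r) (Fin r) ℝ) (Q : Matrix (Fin ℓ) (Fin r) ℝ)
      (K : Matrix (Fin 1) (Fin r) ℝ), Z0 * Q = P → U0 * Q = K * P →
      Z1 * Q = (A + B * K) * P := by
    intro P Q K hZ hU
    rw [hdata, Matrix.add_mul, Matrix.add_mul, Matrix.mul_assoc, Matrix.mul_assoc, hZ, hU,
      Matrix.mul_assoc]
  have hback : ∀ (P : Matrix (Fin r) (Fin r) ℝ) (Q : Matrix (Fin ℓ) (Fin r) ℝ),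
      P.PosDef → (fromBlocks P (Z1 * Q) (Z1 * Q)ᵀ P).PosDef →
      Z0 * Q = P → C * Z1 * Q = lam • (C * P) →
      (-((A + B * (U0 * Q * P⁻¹)) * P * (A + B * (U0 * Q * P⁻¹))ᵀ - P)).PosDef ∧
      C * (A + B * (U0 * Q * P⁻¹)) = lam • C := by
    intro P Q hP hblock hZ hC
    have hdet : IsUnit P.det := (isUnit_iff_isUnit_det P).1 hP.isUnit
    have hF := hclosed P Q (U0 * Q * P⁻¹) hZ (nonsing_inv_mul_cancel_right _ _ hdet).symm
    rw [hF] at hblock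
    refine ⟨(posDef_fromBlocks_iff_lyapunov _ hP).1 hblock, ?_⟩
    rw [Matrix.mul_assoc, hF, ← Matrix.mul_assoc, ← Matrix.smul_mul] at hC
    simpa only [mul_nonsing_inv_cancel_right _ _ hdet] using congrArg (· * P⁻¹) hC
  refine ⟨⟨?_, ?_⟩, hback⟩
  · rintro ⟨K, P, hP, hlyap, hC⟩
    obtain ⟨N, hN⟩ := exists_mul_eq_one_of_rank_eq_card (fromRows U0 Z0)
      (by simpa [add_comm] using hrank)
    have hQ : fromRows U0 Z0 * (N * fromRows (K * P) P) = fromRows (K * P) P := by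
      rw [← Matrix.mul_assoc, hN, Matrix.one_mul]
    rw [fromRows_mul, fromRows_inj.eq_iff] at hQ
    obtain ⟨hU, hZ⟩ := hQ
    have hF := hclosed P _ K hZ hU
    refine ⟨P, _, hP, ?_, hZ, ?_⟩
    · rw [hF]
      exact (posDef_fromBlocks_iff_lyapunov _ hP).2 hlyap
    · rw [Matrix.mul_assoc, hF, ← Matrix.mul_assoc, hC, Matrix.smul_mul]
  · rintro ⟨P, Q, hP, hblock, hZ, hC⟩
    exact ⟨U0 * Q * P⁻¹, P, hP, hback P Q hP hblock hZ hC⟩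
end

section
/- Let n, T be natural numbers with T ≥ 2n. Let A ∈ ℝ^{n×n}, B ∈ ℝ^{n×1}, C ∈ ℝ^{1×n}, and assume the observability matrix O = [C; CA; …; CA^{n−1}] ∈ ℝ^{n×n} is invertible. Let u : ℕ → ℝ be an input sequence and x : ℕ → ℝ^n, y : ℕ → ℝ a trajectory satisfying x(t+1) = A x(t) + B u(t) and y(t) = C x(t) for all t. Define the Hankel matrices U ∈ ℝ^{(n+1)×(T−n+1)} with (i,j) entry u(i+j) for 0 ≤ i ≤ n, 0 ≤ j ≤ T−n, and Y ∈ ℝ^{n×(T−n+1)} with (i,j) entry y(i+j) for 0 ≤ i ≤ n−1, and the state data matrix X = [x(0), x(1), …, x(T−n)] ∈ ℝ^{n×(T−n+1)}. If the stacked matrix [U; X] ∈ ℝ^{(2n+1)×(T−n+1)} has rank 2n+1, then the stacked matrix [U; Y] ∈ ℝ^{(2n+1)×(T−n+1)} also has rank 2n+1. -/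
open Matrix

/-- Variation of constants for the single-input system `x (t + 1) = A x t + B u t`. -/
lemma state_add_eq {n : ℕ} (A : Matrix (Fin n) (Fin n) ℝ) (B : Matrix (Fin n) (Fin 1) ℝ)
    (u : ℕ → ℝ) (x : ℕ → Fin n → ℝ)
    (hx : ∀ t, x (t + 1) = A.mulVec (x t) + B.mulVec (fun _ => u t)) (t i : ℕ) :
    x (t + i) = (A ^ i).mulVec (x t)
      + ∑ k ∈ Finset.range i, (A ^ (i - 1 - k) * B).mulVec (fun _ => u (t + k)) := by
  induction i with
  | zero => simp
  | succ i ih =>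
    have hshift : ∀ k ∈ Finset.range i,
        A.mulVec ((A ^ (i - 1 - k) * B).mulVec (fun _ => u (t + k)))
          = (A ^ (i + 1 - 1 - k) * B).mulVec (fun _ => u (t + k)) := by
      intro k hk
      have hk : k < i := Finset.mem_range.mp hk
      rw [mulVec_mulVec, ← Matrix.mul_assoc, ← pow_succ',
        show i - 1 - k + 1 = i + 1 - 1 - k by omega]
    rw [← add_assoc, hx, ih, mulVec_add, mulVec_sum, Finset.sum_congr rfl hshift,
      mulVec_mulVec, ← pow_succ', Finset.sum_range_succ]
    simp [add_assoc]

/-- The output of a single-input single-output system in terms of a past state and the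
inputs applied since then. -/
lemma output_add_eq {n : ℕ} (A : Matrix (Fin n) (Fin n) ℝ) (B : Matrix (Fin n) (Fin 1) ℝ)
    (C : Matrix (Fin 1) (Fin n) ℝ) (u : ℕ → ℝ) (x : ℕ → Fin n → ℝ) (y : ℕ → ℝ)
    (hx : ∀ t, x (t + 1) = A.mulVec (x t) + B.mulVec (fun _ => u t))
    (hy : ∀ t, y t = C.mulVec (x t) 0) (t i : ℕ) :
    y (t + i) = (C * A ^ i).mulVec (x t) 0
      + ∑ k ∈ Finset.range i, (C * (A ^ (i - 1 - k) * B)) 0 0 * u (t + k) := by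
  rw [hy, state_add_eq A B u x hx, mulVec_add, mulVec_sum, Pi.add_apply, Finset.sum_apply,
    mulVec_mulVec]
  congr 1
  refine Finset.sum_congr rfl fun k _ => ?_
  rw [mulVec_mulVec]
  simp [mulVec, dotProduct]

/-- Rank lemma (SISO): if the stacked input/state Hankel data matrix has full
rank `2n+1`, then so does the stacked input/output Hankel data matrix. -/
theorem stmt_2 (n T : ℕ) (hT : 2 * n ≤ T)
    (A : Matrix (Fin n) (Fin n) ℝ) (B : Matrix (Fin n) (Fin 1) ℝ)
    (C : Matrix (Fin 1) (Fin n) ℝ)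
    (hObs : IsUnit (Matrix.of fun i j : Fin n => (C * A ^ (i : ℕ)) 0 j).det)
    (u : ℕ → ℝ) (x : ℕ → Fin n → ℝ) (y : ℕ → ℝ)
    (hx : ∀ t, x (t + 1) = A.mulVec (x t) + B.mulVec (fun _ => u t))
    (hy : ∀ t, y t = C.mulVec (x t) 0)
    (hrank : (fromRows
        (Matrix.of fun (i : Fin (n + 1)) (j : Fin (T - n + 1)) => u ((i : ℕ) + (j : ℕ)))
        (Matrix.of fun (i : Fin n) (j : Fin (T - n + 1)) => x (j : ℕ) i)).rank
      = 2 * n + 1) :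
    (fromRows
        (Matrix.of fun (i : Fin (n + 1)) (j : Fin (T - n + 1)) => u ((i : ℕ) + (j : ℕ)))
        (Matrix.of fun (i : Fin n) (j : Fin (T - n + 1)) => y ((i : ℕ) + (j : ℕ)))).rank
      = 2 * n + 1 := by
  set U : Matrix (Fin (n + 1)) (Fin (T - n + 1)) ℝ := Matrix.of fun i j => u ((i : ℕ) + (j : ℕ))
    with hU
  set X : Matrix (Fin n) (Fin (T - n + 1)) ℝ := Matrix.of fun i j => x (j : ℕ) i with hX
  set O : Matrix (Fin n) (Fin n) ℝ := Matrix.of fun i j => (C * A ^ (i : ℕ)) 0 j with hO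
  let G : Matrix (Fin n) (Fin (n + 1)) ℝ := Matrix.of fun i k =>
    if (k : ℕ) < i then (C * (A ^ ((i : ℕ) - 1 - k) * B)) 0 0 else 0
  have hY : (Matrix.of fun (i : Fin n) (j : Fin (T - n + 1)) => y ((i : ℕ) + (j : ℕ)))
      = G * U + O * X := by
    ext i j
    have hG : (G * U) i j = ∑ k ∈ Finset.range i,
        (C * (A ^ ((i : ℕ) - 1 - k) * B)) 0 0 * u (j + k) := by
      simp only [Matrix.mul_apply, G, hU, of_apply, ite_mul, zero_mul]
      rw [Fin.sum_univ_eq_sum_range (fun k => if k < (i : ℕ) then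
        (∑ l, C 0 l * ∑ m, (A ^ ((i : ℕ) - 1 - k)) l m * B m 0) * u (k + j) else 0),
        ← Finset.sum_filter]
      refine Finset.sum_congr ?_ fun k _ => by rw [add_comm k]
      ext k
      simp only [Finset.mem_filter, Finset.mem_range]
      omega
    have hOX : (O * X) i j = (C * A ^ (i : ℕ)).mulVec (x j) 0 := rfl
    rw [Matrix.add_apply, hG, hOX, of_apply, add_comm (i : ℕ),
      output_add_eq A B C u x y hx hy, add_comm]
  have hdet : IsUnit (fromBlocks 1 0 G O).det := by
    rwa [det_fromBlocks_zero₁₂, det_one, one_mul]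
  have hfactor : fromRows U (G * U + O * X) = fromBlocks 1 0 G O * fromRows U X := by
    simp [fromBlocks_mul_fromRows]
  rw [hY, hfactor, rank_mul_eq_right_of_isUnit_det _ _ hdet, hrank]
end

section
/- Let n, N be natural numbers with N ≥ 2n ≥ 2. Let U_N ∈ ℝ^{n×N} and X_0 ∈ ℝ^{n×N} be matrices such that the stacked matrix [U_N; X_0] ∈ ℝ^{2n×N} has rank 2n (full row rank). Let W ∈ ℝ^{N×(N−n)} be a matrix whose columns form a basis of the kernel of X_0 (so X_0 W = 0, W has rank N−n, and the column space of W equals ker X_0). Let 𝓕 ∈ ℝ^{n×n} be invertible and 𝓞 ∈ ℝ^{n×n} arbitrary, and set Y_N = 𝓞 X_0 + 𝓕 U_N. Then the matrix Y_N W ∈ ℝ^{n×(N−n)} has rank n. -/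
open Matrix

/-- Rank of `Y_N X_null`: if `[U_N; X_0]` has full row rank `2n`, `W` is a basis of
`ker X_0`, `𝓕` is invertible and `Y_N = 𝓞 X_0 + 𝓕 U_N`, then `rank (Y_N W) = n`. -/
theorem stmt_6 (n N : ℕ) (hn : 1 ≤ n) (hN : 2 * n ≤ N)
    (UN X0 : Matrix (Fin n) (Fin N) ℝ)
    (hrank : (fromRows UN X0).rank = 2 * n)
    (W : Matrix (Fin N) (Fin (N - n)) ℝ)
    (hXW : X0 * W = 0)
    (hWrank : W.rank = N - n)
    (hspan : ∀ v : Fin N → ℝ, X0.mulVec v = 0 → ∃ c : Fin (N - n) → ℝ, W.mulVec c = v)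
    (O F : Matrix (Fin n) (Fin n) ℝ) (hF : IsUnit F.det)
    (YN : Matrix (Fin n) (Fin N) ℝ) (hY : YN = O * X0 + F * UN) :
    (YN * W).rank = n := by
  have hYW : YN * W = F * (UN * W) := by
    rw [hY, Matrix.add_mul, Matrix.mul_assoc, hXW, Matrix.mul_zero, zero_add, Matrix.mul_assoc]
  rw [hYW, rank_mul_eq_right_of_isUnit_det F _ hF]
  have hstack : LinearMap.range (fromRows UN X0).mulVecLin = ⊤ := by
    apply Submodule.eq_top_of_finrank_eq
    change (fromRows UN X0).rank = _
    rw [hrank, Module.finrank_fintype_fun_eq_card, Fintype.card_sum, Fintype.card_fin, two_mul]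
  have htop : LinearMap.range (UN * W).mulVecLin = ⊤ := by
    rw [LinearMap.range_eq_top] at hstack ⊢
    intro y
    obtain ⟨v, hv⟩ := hstack (Sum.elim y 0)
    rw [mulVecLin_apply, fromRows_mulVec] at hv
    have hU : UN *ᵥ v = y := funext fun i => congrFun hv (Sum.inl i)
    have hX : X0 *ᵥ v = 0 := funext fun i => congrFun hv (Sum.inr i)
    obtain ⟨c, hc⟩ := hspan v hX
    refine ⟨c, ?_⟩
    rw [mulVecLin_apply, ← mulVec_mulVec, hc, hU]
  rw [Matrix.rank, htop, finrank_top, Module.finrank_fintype_fun_eq_card, Fintype.card_fin]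
end

section
/- Let n, m, p, d be positive natural numbers. Let A ∈ ℝ^{n×n}, B ∈ ℝ^{n×m}, C ∈ ℝ^{p×n} with C A^k B = 0 for every k with 0 ≤ k ≤ d−2. Define 𝓞_d = [C A^d; …; C A^{d+n−1}] ∈ ℝ^{np×n} and 𝓕_d ∈ ℝ^{np×nm} as the block matrix whose (i,j) block (0 ≤ i,j ≤ n−1) equals C A^{d−1+i−j} B if j ≤ i and zero otherwise. Assume 𝓕_d has a right inverse R ∈ ℝ^{nm×np}, i.e., 𝓕_d R = I_{np}. Then for every initial state x₀ ∈ ℝ^n and every target vector v ∈ ℝ^{np} with all entries nonnegative, there exists an input sequence u(0), …, u(n−1) (namely the blocks of R(v − 𝓞_d x₀)) such that the trajectory x(t+1) = A x(t) + B u(t), y(t) = C x(t) with x(0) = x₀ satisfies [y(d); …; y(n+d−1)] = v; in particular y(d), …, y(n+d−1) are all nonnegative. -/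
open Matrix

/-- The shifted observability matrix `𝓞_d = [C A^d; …; C A^{d+n−1}]`, with rows indexed
by `Fin n × Fin p` (block `i` is `C A^{d+i}`). -/
def obsMatD {n p : ℕ} (d : ℕ) (A : Matrix (Fin n) (Fin n) ℝ) (C : Matrix (Fin p) (Fin n) ℝ) :
    Matrix (Fin n × Fin p) (Fin n) ℝ :=
  Matrix.of fun ia j => (C * A ^ (d + (ia.1 : ℕ))) ia.2 j

/-- The block Toeplitz matrix `𝓕_d` with `(i,j)` block equal to `C A^{d−1+i−j} B` when
`j ≤ i` and `0` otherwise, `0 ≤ i, j ≤ n−1`. -/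
def fMatD {n m p : ℕ} (d : ℕ) (A : Matrix (Fin n) (Fin n) ℝ) (B : Matrix (Fin n) (Fin m) ℝ)
    (C : Matrix (Fin p) (Fin n) ℝ) :
    Matrix (Fin n × Fin p) (Fin n × Fin m) ℝ :=
  Matrix.of fun ia jb =>
    if (jb.1 : ℕ) ≤ (ia.1 : ℕ) then
      (C * A ^ (d - 1 + (ia.1 : ℕ) - (jb.1 : ℕ)) * B) ia.2 jb.2
    else 0

/-- Variation of constants for the discrete-time linear system `x (t + 1) = A x t + B u t`. -/
theorem state_eq_pow_mulVec_add_sum {n m : ℕ} (A : Matrix (Fin n) (Fin n) ℝ)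
    (B : Matrix (Fin n) (Fin m) ℝ) (u : ℕ → Fin m → ℝ) (x : ℕ → Fin n → ℝ)
    (hx : ∀ t, x (t + 1) = A.mulVec (x t) + B.mulVec (u t)) (t : ℕ) :
    x t = (A ^ t).mulVec (x 0) +
      ∑ j ∈ Finset.range t, (A ^ (t - 1 - j) * B).mulVec (u j) := by
  induction t with
  | zero => simp
  | succ t ih =>
    rw [hx, ih, Finset.sum_range_succ, Matrix.mulVec_add, Matrix.mulVec_mulVec, ← pow_succ',
      Matrix.mulVec_sum, add_assoc]
    congr 2
    · refine Finset.sum_congr rfl fun j hj => ?_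
      have hj' := Finset.mem_range.mp hj
      rw [Matrix.mulVec_mulVec, ← Matrix.mul_assoc, ← pow_succ']
      congr 4
      omega
    · simp

/-- The batch response identity `[y(d); …; y(n+d−1)] = 𝓞_d x(0) + 𝓕_d [u(0); …; u(n−1)]`. -/
theorem output_eq_obsMatD_add_fMatD {n m p d : ℕ} (hd : 0 < d)
    (A : Matrix (Fin n) (Fin n) ℝ) (B : Matrix (Fin n) (Fin m) ℝ)
    (C : Matrix (Fin p) (Fin n) ℝ) (hrel : ∀ k, k + 2 ≤ d → C * A ^ k * B = 0)
    (u : ℕ → Fin m → ℝ) (x : ℕ → Fin n → ℝ)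
    (hx : ∀ t, x (t + 1) = A.mulVec (x t) + B.mulVec (u t)) (i : Fin n) (a : Fin p) :
    C.mulVec (x (d + (i : ℕ))) a =
      (obsMatD d A C).mulVec (x 0) (i, a) +
        (fMatD d A B C).mulVec (fun jb => u jb.1 jb.2) (i, a) := by
  rw [state_eq_pow_mulVec_add_sum A B u x hx, Matrix.mulVec_add, Matrix.mulVec_mulVec,
    Matrix.mulVec_sum, Pi.add_apply, Finset.sum_apply]
  congr 1
  have hF : (fMatD d A B C).mulVec (fun jb => u jb.1 jb.2) (i, a) =
      ∑ j : Fin n, if (j : ℕ) ≤ i then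
        (C * A ^ (d - 1 + (i : ℕ) - (j : ℕ)) * B).mulVec (u j) a else 0 := by
    simp only [Matrix.mulVec, dotProduct, fMatD, Matrix.of_apply, Fintype.sum_prod_type]
    refine Finset.sum_congr rfl fun j _ => ?_
    split_ifs <;> simp
  rw [hF, Fin.sum_univ_eq_sum_range (fun j : ℕ => if j ≤ (i : ℕ) then
    (C * A ^ (d - 1 + (i : ℕ) - j) * B).mulVec (u j) a else 0) n]
  have hi := i.isLt
  rw [← Finset.sum_subset (Finset.range_subset_range.mpr (show (i : ℕ) + 1 ≤ n by omega)),
    ← Finset.sum_subset (Finset.range_subset_range.mpr (show (i : ℕ) + 1 ≤ d + i by omega))]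
  · refine Finset.sum_congr rfl fun j hj => ?_
    have hj' := Finset.mem_range.mp hj
    rw [if_pos (by omega), Matrix.mulVec_mulVec, ← Matrix.mul_assoc,
      show d + (i : ℕ) - 1 - j = d - 1 + i - j by omega]
  · intro j hj hj'
    rw [Finset.mem_range] at hj hj'
    rw [Matrix.mulVec_mulVec, ← Matrix.mul_assoc, hrel _ (by omega), Matrix.zero_mulVec,
      Pi.zero_apply]
  · intro j _ hj'
    rw [Finset.mem_range] at hj'
    rw [if_neg (by omega)]

/-- Verifying the equivalence condition: if `𝓕_d` has a right inverse `R`, then from any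
initial state `x₀` and for any nonnegative target `v` there is an input sequence (namely
the blocks of `R(v − 𝓞_d x₀)`) whose trajectory satisfies `[y(d); …; y(n+d−1)] = v`,
so that `y(d), …, y(n+d−1)` are all nonnegative. -/
theorem stmt_8 (n m p d : ℕ) (hn : 0 < n) (hm : 0 < m) (hp : 0 < p) (hd : 0 < d)
    (A : Matrix (Fin n) (Fin n) ℝ) (B : Matrix (Fin n) (Fin m) ℝ)
    (C : Matrix (Fin p) (Fin n) ℝ)
    (hrel : ∀ k, k + 2 ≤ d → C * A ^ k * B = 0)
    (R : Matrix (Fin n × Fin m) (Fin n × Fin p) ℝ)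
    (hR : fMatD d A B C * R = 1) :
    ∀ (x₀ : Fin n → ℝ) (v : Fin n × Fin p → ℝ), (∀ ia, 0 ≤ v ia) →
      ∃ (u : ℕ → Fin m → ℝ) (x : ℕ → Fin n → ℝ) (y : ℕ → Fin p → ℝ),
        x 0 = x₀ ∧
        (∀ (i : Fin n) (b : Fin m),
          u (i : ℕ) b = R.mulVec (v - (obsMatD d A C).mulVec x₀) (i, b)) ∧
        (∀ t, x (t + 1) = A.mulVec (x t) + B.mulVec (u t)) ∧
        (∀ t, y t = C.mulVec (x t)) ∧
        (∀ (i : Fin n) (a : Fin p), y (d + (i : ℕ)) a = v (i, a)) ∧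
        (∀ (i : Fin n) (a : Fin p), 0 ≤ y (d + (i : ℕ)) a) := by
  intro x₀ v hv
  let w := R.mulVec (v - (obsMatD d A C).mulVec x₀)
  let u : ℕ → Fin m → ℝ := fun t b => if h : t < n then w (⟨t, h⟩, b) else 0
  let x : ℕ → Fin n → ℝ := fun t =>
    Nat.rec x₀ (fun s xs => A.mulVec xs + B.mulVec (u s)) t
  have hu : (fun jb : Fin n × Fin m => u jb.1 jb.2) = w := by
    funext jb
    simp [u]
  have hy : ∀ (i : Fin n) (a : Fin p), C.mulVec (x (d + (i : ℕ))) a = v (i, a) := by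
    intro i a
    rw [output_eq_obsMatD_add_fMatD hd A B C hrel u x (fun _ => rfl), hu, Matrix.mulVec_mulVec,
      hR, Matrix.one_mulVec]
    exact add_sub_cancel _ _
  exact ⟨u, x, fun t => C.mulVec (x t), rfl, fun i b => congrFun hu (i, b), fun _ => rfl,
    fun _ => rfl, hy, fun i a => (hv (i, a)).trans_eq (hy i a).symm⟩
end

section
/- Let n, N be natural numbers with N ≥ 2n ≥ 2. Let X_0 ∈ ℝ^{n×N} have a right inverse L ∈ ℝ^{N×n} (X_0 L = I_n), let Y_N ∈ ℝ^{n×N}, and let W ∈ ℝ^{N×(N−n)} satisfy X_0 W = 0. Assume Y_N W ∈ ℝ^{n×(N−n)} has a right inverse R ∈ ℝ^{(N−n)×n} (i.e., Y_N W R = I_n). Then for every x₀ ∈ ℝ^n and every v ∈ ℝ^n, the vector α := L x₀ + W R (v − Y_N L x₀) ∈ ℝ^N satisfies X_0 α = x₀ and Y_N α = v. -/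
open Matrix

/-- Data-driven interpolation: with `X₀ L = I`, `X₀ W = 0`, and `Y_N W R = I`, the vector
`α = L x₀ + W R (v − Y_N L x₀)` satisfies `X₀ α = x₀` and `Y_N α = v`. -/
theorem stmt_9 (n N : ℕ) (hn : 1 ≤ n) (hN : 2 * n ≤ N)
    (X0 : Matrix (Fin n) (Fin N) ℝ) (L : Matrix (Fin N) (Fin n) ℝ)
    (hL : X0 * L = 1)
    (YN : Matrix (Fin n) (Fin N) ℝ)
    (W : Matrix (Fin N) (Fin (N - n)) ℝ) (hW : X0 * W = 0)
    (R : Matrix (Fin (N - n)) (Fin n) ℝ) (hR : YN * W * R = 1) :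
    ∀ (x₀ v : Fin n → ℝ),
      X0.mulVec (L.mulVec x₀ +
          W.mulVec (R.mulVec (v - YN.mulVec (L.mulVec x₀)))) = x₀ ∧
      YN.mulVec (L.mulVec x₀ +
          W.mulVec (R.mulVec (v - YN.mulVec (L.mulVec x₀)))) = v := by
  intro x₀ v
  constructor
  · rw [mulVec_add, mulVec_mulVec, hL, one_mulVec, mulVec_mulVec, hW, zero_mulVec, add_zero]
  · rw [mulVec_add, mulVec_mulVec _ YN W, mulVec_mulVec _ (YN * W) R, hR, one_mulVec,
      add_sub_cancel]
end

section
/- Let r, m, ℓ be positive natural numbers, and let U0 ∈ ℝ^{m×ℓ} and Z0 ∈ ℝ^{r×ℓ} be such that the stacked matrix [U0; Z0] ∈ ℝ^{(m+r)×ℓ} has rank m+r (full row rank). Then for every K ∈ ℝ^{m×r} there exists G ∈ ℝ^{ℓ×r} such that U0 G = K and Z0 G = I_r; moreover, for any such G and any matrices A ∈ ℝ^{r×r}, B ∈ ℝ^{r×m}, the closed-loop matrix satisfies A + B K = (A Z0 + B U0) G. -/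
open Matrix

/-- If `M` has full row rank, then `M * G = N` is solvable in `G` for every `N`. -/
theorem exists_mul_eq_of_rank_eq_card {ι κ n : Type*} [Fintype ι] [Fintype κ]
    (M : Matrix ι κ ℝ) (hM : M.rank = Fintype.card ι) (N : Matrix ι n ℝ) :
    ∃ G : Matrix κ n ℝ, M * G = N := by
  have hrange : LinearMap.range M.mulVecLin = ⊤ := by
    apply Submodule.eq_top_of_finrank_eq
    rw [Module.finrank_fintype_fun_eq_card]
    exact hM
  choose g hg using fun j => LinearMap.range_eq_top.mp hrange (N.col j)
  refine ⟨(of g)ᵀ, ?_⟩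
  ext i j
  exact congrFun (hg j) i

/-- Data-dependent closed-loop representation: if `[U0; Z0]` has full row rank `m + r`,
then for every gain `K` there exists `G` with `U0 G = K` and `Z0 G = I`; and for any such
`G` and any `A`, `B`, one has `A + B K = (A Z0 + B U0) G`. -/
theorem stmt_11 (r m ℓ : ℕ) (hr : 0 < r) (hm : 0 < m) (hℓ : 0 < ℓ)
    (U0 : Matrix (Fin m) (Fin ℓ) ℝ) (Z0 : Matrix (Fin r) (Fin ℓ) ℝ)
    (hrank : (fromRows U0 Z0).rank = m + r) :
    ∀ K : Matrix (Fin m) (Fin r) ℝ,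
      (∃ G : Matrix (Fin ℓ) (Fin r) ℝ, U0 * G = K ∧ Z0 * G = 1) ∧
      (∀ G : Matrix (Fin ℓ) (Fin r) ℝ, U0 * G = K → Z0 * G = 1 →
        ∀ (A : Matrix (Fin r) (Fin r) ℝ) (B : Matrix (Fin r) (Fin m) ℝ),
          A + B * K = (A * Z0 + B * U0) * G) := by
  intro K
  constructor
  · obtain ⟨G, hG⟩ := exists_mul_eq_of_rank_eq_card (fromRows U0 Z0) (by simpa using hrank)
      (fromRows K (1 : Matrix (Fin r) (Fin r) ℝ))
    rw [fromRows_mul, fromRows_inj.eq_iff] at hG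
    exact ⟨G, hG⟩
  · rintro G rfl hZ A B
    rw [Matrix.add_mul, Matrix.mul_assoc, Matrix.mul_assoc, hZ, Matrix.mul_one]
end

section
/- Let n, m, p be positive natural numbers. Let A ∈ ℝ^{n×n}, B ∈ ℝ^{n×m}, C ∈ ℝ^{p×n}, let O = [C; CA; …; CA^{n−1}] ∈ ℝ^{np×n}, and assume there exists L ∈ ℝ^{n×np} with L O = I_n. Define F₁ ∈ ℝ^{np×nm} with (i,j) block (0 ≤ i,j ≤ n−1) equal to C A^{i−1−j} B if j ≤ i−1 and zero otherwise, F₂ = [C A^{n−1} B, …, C B] ∈ ℝ^{p×nm}, 𝒜_y = C A^n L, and 𝒜_u = F₂ − C A^n L F₁. Suppose x_ss ∈ ℝ^n, u_ss ∈ ℝ^m, y_ss ∈ ℝ^p satisfy x_ss = A x_ss + B u_ss and y_ss = C x_ss. Then 𝒜_u · (𝟙_n ⊗ u_ss) + 𝒜_y · (𝟙_n ⊗ y_ss) = y_ss, where 𝟙_n ⊗ u_ss ∈ ℝ^{nm} denotes the vector obtained by stacking n copies of u_ss, and similarly for 𝟙_n ⊗ y_ss. -/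
open Matrix

/-- The observability matrix `O = [C; CA; …; CA^{n−1}]`, with rows indexed by
`Fin n × Fin p` (block `i` is `C Aⁱ`). -/
def obsMat {n p : ℕ} (A : Matrix (Fin n) (Fin n) ℝ) (C : Matrix (Fin p) (Fin n) ℝ) :
    Matrix (Fin n × Fin p) (Fin n) ℝ :=
  Matrix.of fun ia j => (C * A ^ (ia.1 : ℕ)) ia.2 j

/-- The block Toeplitz matrix `F₁` with `(i,j)` block equal to `C A^{i−1−j} B` when
`j ≤ i−1` (i.e. `j < i`) and `0` otherwise, `0 ≤ i, j ≤ n−1`. -/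
def f1Mat {n m p : ℕ} (A : Matrix (Fin n) (Fin n) ℝ) (B : Matrix (Fin n) (Fin m) ℝ)
    (C : Matrix (Fin p) (Fin n) ℝ) :
    Matrix (Fin n × Fin p) (Fin n × Fin m) ℝ :=
  Matrix.of fun ia jb =>
    if (jb.1 : ℕ) < (ia.1 : ℕ) then (C * A ^ ((ia.1 : ℕ) - 1 - (jb.1 : ℕ)) * B) ia.2 jb.2 else 0

/-- The block row `F₂ = [C A^{n−1} B, C A^{n−2} B, …, C B]`, block `j` being `C A^{n−1−j} B`. -/
def f2Mat {n m p : ℕ} (A : Matrix (Fin n) (Fin n) ℝ) (B : Matrix (Fin n) (Fin m) ℝ)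
    (C : Matrix (Fin p) (Fin n) ℝ) :
    Matrix (Fin p) (Fin n × Fin m) ℝ :=
  Matrix.of fun a jb => (C * A ^ (n - 1 - (jb.1 : ℕ)) * B) a jb.2

/-- Telescoped form of the steady-state equation after `k` steps. -/
theorem sum_range_pow_mulVec_of_steady {n m : ℕ} {A : Matrix (Fin n) (Fin n) ℝ}
    {B : Matrix (Fin n) (Fin m) ℝ} {x : Fin n → ℝ} {u : Fin m → ℝ}
    (hx : x = A *ᵥ x + B *ᵥ u) (k : ℕ) :
    ∑ j ∈ Finset.range k, A ^ (k - 1 - j) *ᵥ (B *ᵥ u) = x - A ^ k *ᵥ x := by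
  rw [Finset.sum_range_reflect (fun i => A ^ i *ᵥ (B *ᵥ u))]
  have hB : B *ᵥ u = x - A *ᵥ x := eq_sub_of_add_eq' hx.symm
  have hstep (i : ℕ) : A ^ i *ᵥ (B *ᵥ u) = A ^ i *ᵥ x - A ^ (i + 1) *ᵥ x := by
    rw [hB, mulVec_sub, mulVec_mulVec, ← pow_succ]
  simp_rw [hstep]
  rw [Finset.sum_range_sub' (fun i => A ^ i *ᵥ x), pow_zero, one_mulVec]

/-- The output form of the telescoped steady-state equation. -/
theorem sum_range_output_of_steady {n m p : ℕ} {A : Matrix (Fin n) (Fin n) ℝ}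
    {B : Matrix (Fin n) (Fin m) ℝ} (C : Matrix (Fin p) (Fin n) ℝ) {x : Fin n → ℝ}
    {u : Fin m → ℝ} (hx : x = A *ᵥ x + B *ᵥ u) (k : ℕ) (a : Fin p) :
    ∑ j ∈ Finset.range k, ((C * A ^ (k - 1 - j) * B) *ᵥ u) a =
      (C *ᵥ x) a - ((C * A ^ k) *ᵥ x) a := by
  have h := congrFun (congrArg (C *ᵥ ·) (sum_range_pow_mulVec_of_steady hx k)) a
  simpa only [mulVec_sum, mulVec_sub, mulVec_mulVec, Finset.sum_apply, Pi.sub_apply,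
    Matrix.mul_assoc] using h

theorem f2Mat_mulVec_of_steady {n m p : ℕ} {A : Matrix (Fin n) (Fin n) ℝ}
    {B : Matrix (Fin n) (Fin m) ℝ} (C : Matrix (Fin p) (Fin n) ℝ) {x : Fin n → ℝ}
    {u : Fin m → ℝ} (hx : x = A *ᵥ x + B *ᵥ u) :
    f2Mat A B C *ᵥ (fun jb => u jb.2) = C *ᵥ x - (C * A ^ n) *ᵥ x := by
  ext a
  rw [Pi.sub_apply, ← sum_range_output_of_steady C hx n a, Finset.sum_range]
  simp only [mulVec, dotProduct, f2Mat, of_apply, Fintype.sum_prod_type]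

theorem f1Mat_mulVec_of_steady {n m p : ℕ} {A : Matrix (Fin n) (Fin n) ℝ}
    {B : Matrix (Fin n) (Fin m) ℝ} (C : Matrix (Fin p) (Fin n) ℝ) {x : Fin n → ℝ}
    {u : Fin m → ℝ} (hx : x = A *ᵥ x + B *ᵥ u) :
    f1Mat A B C *ᵥ (fun jb => u jb.2) = (fun ia => (C *ᵥ x) ia.2) - obsMat A C *ᵥ x := by
  ext ⟨i, a⟩
  have hO : (obsMat A C *ᵥ x) (i, a) = ((C * A ^ (i : ℕ)) *ᵥ x) a := rfl
  have hF : (f1Mat A B C *ᵥ (fun jb => u jb.2)) (i, a) =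
      ∑ j : Fin n, if (j : ℕ) < i then ((C * A ^ ((i : ℕ) - 1 - j) * B) *ᵥ u) a else 0 := by
    simp only [mulVec, dotProduct, f1Mat, of_apply, Fintype.sum_prod_type]
    refine Finset.sum_congr rfl fun j _ => ?_
    split_ifs <;> simp
  rw [Pi.sub_apply, hO, ← sum_range_output_of_steady C hx i a, hF,
    ← Finset.sum_range
      (fun j => if j < (i : ℕ) then ((C * A ^ ((i : ℕ) - 1 - j) * B) *ᵥ u) a else 0),
    ← Finset.sum_filter]
  congr 1
  ext j
  simp only [Finset.mem_filter, Finset.mem_range]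
  omega

/-- Steady state of the behavioral dynamics: if `x_ss = A x_ss + B u_ss` and
`y_ss = C x_ss`, then with `𝒜_u = F₂ − C Aⁿ L F₁` and `𝒜_y = C Aⁿ L`,
`𝒜_u (𝟙ₙ ⊗ u_ss) + 𝒜_y (𝟙ₙ ⊗ y_ss) = y_ss`. -/
theorem stmt_13 (n m p : ℕ) (hn : 0 < n) (hm : 0 < m) (hp : 0 < p)
    (A : Matrix (Fin n) (Fin n) ℝ) (B : Matrix (Fin n) (Fin m) ℝ)
    (C : Matrix (Fin p) (Fin n) ℝ)
    (L : Matrix (Fin n) (Fin n × Fin p) ℝ) (hL : L * obsMat A C = 1)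
    (xss : Fin n → ℝ) (uss : Fin m → ℝ) (yss : Fin p → ℝ)
    (hxss : xss = A.mulVec xss + B.mulVec uss)
    (hyss : yss = C.mulVec xss) :
    (f2Mat A B C - C * A ^ n * L * f1Mat A B C).mulVec
        (fun ib : Fin n × Fin m => uss ib.2) +
      (C * A ^ n * L).mulVec (fun ia : Fin n × Fin p => yss ia.2) = yss := by
  rw [sub_mulVec, ← mulVec_mulVec, f1Mat_mulVec_of_steady C hxss, f2Mat_mulVec_of_steady C hxss,
    mulVec_sub, mulVec_mulVec, Matrix.mul_assoc (C * A ^ n) L (obsMat A C), hL, Matrix.mul_one,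
    hyss]
  abel
end

section
/- Let n, m, p, T be natural numbers with T ≥ n ≥ 1. Let A ∈ ℝ^{n×n}, B ∈ ℝ^{n×m}, C ∈ ℝ^{p×n}, let u : ℕ → ℝ^m be any input, and let x : ℕ → ℝ^n, y : ℕ → ℝ^p be a trajectory with x(t+1) = A x(t) + B u(t) and y(t) = C x(t) for all t. Let U ∈ ℝ^{(n+1)m×(T−n+1)} be the block Hankel matrix with (i,j) block u(i+j) for 0 ≤ i ≤ n, and Y ∈ ℝ^{np×(T−n+1)} the block Hankel matrix with (i,j) block y(i+j) for 0 ≤ i ≤ n−1. Then the rank of the stacked matrix [U; Y] is at most (n+1)m + n. -/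
open Matrix

/-- If every row of `M` is a linear combination of the rows of `W`, then the rank of `M` is at
most the number of rows of `W`. -/
theorem Matrix.rank_le_card_of_row_mem_span {K l k q : Type*} [Field K] [Fintype l] [Fintype k]
    [Fintype q] (M : Matrix l q K) (W : k → q → K)
    (h : ∀ i, M i ∈ Submodule.span K (Set.range W)) : M.rank ≤ Fintype.card k := by
  rw [Matrix.rank_eq_finrank_span_row]
  calc Module.finrank K (Submodule.span K (Set.range M.row))
      ≤ Module.finrank K (Submodule.span K (Set.range W)) :=
        Submodule.finrank_mono (Submodule.span_le.2 (Set.range_subset_iff.2 h))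
    _ ≤ Fintype.card k := finrank_range_le_card W

/-- If the coordinates of a vector-valued function `v` lie in a subspace `S` of scalar functions,
then so do the coordinates of `A *ᵥ v`. -/
theorem Submodule.mulVec_apply_mem {K k l q : Type*} [Field K] [Fintype k]
    (S : Submodule K (q → K)) (A : Matrix l k K) (v : q → k → K)
    (hv : ∀ a, (fun j => v j a) ∈ S) (b : l) : (fun j => (A.mulVec (v j)) b) ∈ S := by
  have : (fun j => (A.mulVec (v j)) b) = ∑ a, A b a • fun j => v j a := by
    ext j
    simp [Matrix.mulVec, dotProduct]
  rw [this]
  exact S.sum_mem fun a _ => S.smul_mem _ (hv a)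

/-- Rank bound (MIMO case): the stacked block Hankel data matrix `[U; Y]` of a linear
system trajectory has rank at most `(n+1)m + n`. -/
theorem stmt_14 (n m p T : ℕ) (hn : 1 ≤ n) (hT : n ≤ T)
    (A : Matrix (Fin n) (Fin n) ℝ) (B : Matrix (Fin n) (Fin m) ℝ)
    (C : Matrix (Fin p) (Fin n) ℝ)
    (u : ℕ → Fin m → ℝ) (x : ℕ → Fin n → ℝ) (y : ℕ → Fin p → ℝ)
    (hx : ∀ t, x (t + 1) = A.mulVec (x t) + B.mulVec (u t))
    (hy : ∀ t, y t = C.mulVec (x t)) :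
    (fromRows
        (Matrix.of fun (ib : Fin (n + 1) × Fin m) (j : Fin (T - n + 1)) =>
          u ((ib.1 : ℕ) + (j : ℕ)) ib.2)
        (Matrix.of fun (ia : Fin n × Fin p) (j : Fin (T - n + 1)) =>
          y ((ia.1 : ℕ) + (j : ℕ)) ia.2)).rank ≤ (n + 1) * m + n := by
  set W : Fin (n + 1) × Fin m ⊕ Fin n → Fin (T - n + 1) → ℝ :=
    Sum.elim (fun ib j => u (ib.1 + j) ib.2) (fun k j => x j k) with hW
  set S := Submodule.span ℝ (Set.range W)
  have hu : ∀ i < n + 1, ∀ b, (fun j : Fin (T - n + 1) => u (i + j) b) ∈ S := fun i hi b =>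
    Submodule.subset_span ⟨Sum.inl (⟨i, hi⟩, b), rfl⟩
  have hxS : ∀ i < n + 1, ∀ k, (fun j : Fin (T - n + 1) => x (i + j) k) ∈ S := by
    intro i
    induction i with
    | zero =>
      intro _ k
      exact Submodule.subset_span ⟨Sum.inr k, by simp [hW]⟩
    | succ i ih =>
      intro hi k
      have hstep := S.add_mem
        (S.mulVec_apply_mem A (fun j : Fin (T - n + 1) => x (i + j)) (ih (by omega)) k)
        (S.mulVec_apply_mem B (fun j : Fin (T - n + 1) => u (i + j)) (hu i (by omega)) k)
      convert hstep using 1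
      ext j
      simp [Nat.add_right_comm i 1, hx]
  refine (Matrix.rank_le_card_of_row_mem_span _ W ?_).trans_eq (by simp)
  rintro (⟨i, b⟩ | ⟨i, a⟩)
  · exact hu i i.2 b
  · have := S.mulVec_apply_mem C (fun j : Fin (T - n + 1) => x (i + j)) (hxS i (by omega)) a
    simp only [← hy] at this
    exact this
end
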